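/- Let f : Γ_f → Γ_f⁺ and g : Γ_g → Γ_g⁺ be primitive morphisms on finite alphabets such that f(0) and g(0) both start with the letter 0 and have length greater than 1, and let τ : Γ_f → Σ, ρ : Γ_g → Σ be codings. If τ(f^∞(0)) = ρ(g^∞(0)) and this sequence is not periodic, then there exist integers k, m ≥ 1 such that the morphisms f^k and g^m have the same dominant eigenvalue, i.e. λ_f^k = λ_g^m where λ_f and λ_g are the dominant eigenvalues of the incidence matrices of f and g. -/

import Mathlib

/-- A morphism `f : Γ → Γ⁺` applied to a finite word, by concatenation. -/
def applyW {Γ : Type*} (f : Γ → List Γ) (w : List Γ) : List Γ := w.flatMap f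

/-- A morphism applied to an infinite sequence, by concatenation
(meaningful when every `f a` is nonempty: then the `n`-th letter of
`f(σ(0))f(σ(1))⋯` lies within the first `n+1` blocks). -/
def applyS {Γ : Type*} (f : Γ → List Γ) (σ : ℕ → Γ) (n : ℕ) : Γ :=
  ((List.range (n + 1)).flatMap fun i => f (σ i)).getD n (σ 0)

/-- A coding applied letterwise to an infinite sequence. -/
def applyC {Γ S : Type*} (τ : Γ → S) (σ : ℕ → Γ) : ℕ → S := fun n => τ (σ n)

/-- The fixed point `f^∞(a)` of a morphism `f` with `f a = a·u`, `u` nonempty: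
its `n`-th letter is the `n`-th letter of `f^(n+1)(a)` (which has length `> n`). -/
def fixpt {Γ : Type*} (f : Γ → List Γ) (a : Γ) (n : ℕ) : Γ :=
  ((applyW f)^[n + 1] [a]).getD n a


open Filter Topology

namespace Cob

def Agree {Γ : Type*} (y : ℕ → Γ) (n i j : ℕ) : Prop := ∀ t < n, y (i + t) = y (j + t)

structure SS {Γ : Type*} (y : ℕ → Γ) (p : ℕ → ℕ) : Prop where
  p0 : p 0 = 0
  mono : StrictMono p
  p1 : 2 ≤ p 1
  loc : ∀ i j, y i = y j → ∃ l, p (i+1) = p i + l ∧ p (j+1) = p j + l ∧ Agree y l (p i) (p j)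
  prim : ∃ q, ∀ j a, ∃ i, p^[q] j ≤ i ∧ i < p^[q] (j+1) ∧ y i = a

variable {Γ : Type*} {y : ℕ → Γ} {p : ℕ → ℕ}

lemma SS.agree1 (h : SS y p) (n i j : ℕ) (H : Agree y n i j) :
    ∃ l, p (i+n) = p i + l ∧ p (j+n) = p j + l ∧ Agree y l (p i) (p j) := by
  induction n with
  | zero => exact ⟨0, by simp, by simp, fun t ht => by omega⟩
  | succ n ih =>
    obtain ⟨l, h1, h2, h3⟩ := ih (fun t ht => H t (by omega))
    obtain ⟨l', h1', h2', h3'⟩ := h.loc (i+n) (j+n) (H n (by omega))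
    refine ⟨l + l', by rw [← add_assoc, h1', h1]; ring, by rw [← add_assoc, h2', h2]; ring, ?_⟩
    intro t ht
    by_cases htl : t < l
    · exact h3 t htl
    · have := h3' (t - l) (by omega)
      rw [h1, h2] at this
      convert this using 2 <;> omega

lemma SS.agreeP (h : SS y p) (k n i j : ℕ) (H : Agree y n i j) :
    ∃ l, p^[k] (i+n) = p^[k] i + l ∧ p^[k] (j+n) = p^[k] j + l ∧
      Agree y l (p^[k] i) (p^[k] j) := by
  induction k with
  | zero => exact ⟨n, rfl, rfl, H⟩
  | succ k ih =>
    obtain ⟨l, h1, h2, h3⟩ := ih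
    obtain ⟨l', a1, a2, a3⟩ := h.agree1 _ _ _ h3
    simp only [Function.iterate_succ_apply']
    exact ⟨l', by rw [h1, a1], by rw [h2, a2], a3⟩

lemma SS.monoP (h : SS y p) (k : ℕ) : StrictMono (p^[k]) := h.mono.iterate k

lemma SS.P0 (h : SS y p) (k : ℕ) : p^[k] 0 = 0 := Function.iterate_fixed h.p0 k

def len (p : ℕ → ℕ) (k j : ℕ) : ℕ := p^[k] (j+1) - p^[k] j

lemma SS.len_spec (h : SS y p) (k j : ℕ) : p^[k] (j+1) = p^[k] j + len p k j := by
  have := h.monoP k (Nat.lt_succ_self j)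
  simp only [Nat.succ_eq_add_one] at this
  unfold len; omega

lemma SS.len_eq (h : SS y p) (k i j : ℕ) (e : y i = y j) :
    len p k i = len p k j ∧ Agree y (len p k i) (p^[k] i) (p^[k] j) := by
  obtain ⟨l, h1, h2, h3⟩ := h.agreeP k 1 i j (fun t ht => by
    obtain rfl : t = 0 := by omega
    simpa using e)
  have e1 := h.len_spec k i
  have e2 := h.len_spec k j
  have e3 : len p k i = l := by omega
  exact ⟨by omega, by rw [e3]; exact h3⟩

noncomputable def mn (p : ℕ → ℕ) (k : ℕ) : ℕ := sInf (Set.range (len p k))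
noncomputable def mx (p : ℕ → ℕ) (k : ℕ) : ℕ := sSup (Set.range (len p k))

lemma SS.finlen [Finite Γ] (h : SS y p) (k : ℕ) : (Set.range (len p k)).Finite := by
  classical
  have : Set.range (len p k) ⊆ Set.range (fun a : Γ => if ha : ∃ j, y j = a then len p k ha.choose else 0) := by
    rintro _ ⟨j, rfl⟩
    refine ⟨y j, ?_⟩
    have hj : ∃ j', y j' = y j := ⟨j, rfl⟩
    simp only [dif_pos hj]
    exact (h.len_eq k _ _ hj.choose_spec).1
  exact (Set.finite_range _).subset this

lemma SS.mn_le (k j : ℕ) : mn p k ≤ len p k j := Nat.sInf_le ⟨j, rfl⟩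
lemma SS.le_mx [Finite Γ] (h : SS y p) (k j : ℕ) : len p k j ≤ mx p k :=
  le_csSup (h.finlen k).bddAbove ⟨j, rfl⟩
lemma SS.mx_att [Finite Γ] (h : SS y p) (k : ℕ) : ∃ j, len p k j = mx p k :=
  Nat.sSup_mem (Set.range_nonempty _) (h.finlen k).bddAbove
lemma SS.mn_att (k : ℕ) : ∃ j, len p k j = mn p k :=
  Nat.sInf_mem (Set.range_nonempty (len p k))

lemma SS.len_pos (h : SS y p) (k j : ℕ) : 1 ≤ len p k j := by
  have := h.monoP k (Nat.lt_succ_self j)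
  simp only [Nat.succ_eq_add_one] at this
  unfold len; omega

lemma SS.mn_pos (h : SS y p) (k : ℕ) : 1 ≤ mn p k := by
  obtain ⟨j, hj⟩ := SS.mn_att (p := p) k
  rw [← hj]; exact h.len_pos k j

lemma SS.P_add_le [Finite Γ] (h : SS y p) (k j t : ℕ) : p^[k] (j+t) ≤ p^[k] j + t * mx p k := by
  induction t with
  | zero => simp
  | succ t ih =>
    have := h.len_spec k (j+t)
    have := h.le_mx k (j+t)
    rw [← add_assoc, add_mul]; omega

lemma SS.le_P_add (h : SS y p) (k j t : ℕ) : p^[k] j + t * mn p k ≤ p^[k] (j+t) := by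
  induction t with
  | zero => simp
  | succ t ih =>
    have := h.len_spec k (j+t)
    have := SS.mn_le (p := p) k (j+t)
    rw [← add_assoc, add_mul]; omega

lemma SS.P_le [Finite Γ] (h : SS y p) (k t : ℕ) : p^[k] t ≤ t * mx p k := by
  have := h.P_add_le k 0 t
  simpa [h.P0] using this

lemma P_comp (p : ℕ → ℕ) (k q j : ℕ) : p^[k+q] j = p^[k] (p^[q] j) := Function.iterate_add_apply _ _ _ _

lemma SS.mx_add [Finite Γ] (h : SS y p) (k q : ℕ) : mx p (k+q) ≤ mx p q * mx p k := by
  obtain ⟨j, hj⟩ := h.mx_att (k+q)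
  rw [← hj]
  unfold len
  rw [P_comp, P_comp, h.len_spec q j]
  have h1 := h.P_add_le k (p^[q] j) (len p q j)
  have h2 := Nat.mul_le_mul_right (mx p k) (h.le_mx q j)
  omega

lemma SS.mx_le_mn_of [Finite Γ] (h : SS y p) (q : ℕ)
    (hq : ∀ j a, ∃ i, p^[q] j ≤ i ∧ i < p^[q] (j+1) ∧ y i = a) (k : ℕ) :
    mx p k ≤ mn p (k+q) := by
  obtain ⟨j, hj⟩ := SS.mn_att (p := p) (k+q)
  obtain ⟨j0, hj0⟩ := h.mx_att k
  obtain ⟨i, h1, h2, h3⟩ := hq j (y j0)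
  rw [← hj, ← hj0, ← (h.len_eq k i j0 h3).1]
  unfold len
  rw [P_comp, P_comp]
  have a1 := (h.monoP k).monotone h1
  have a2 := (h.monoP k).monotone (Nat.succ_le_of_lt h2)
  simp only [Nat.succ_eq_add_one] at a2
  omega

lemma SS.mx_mono [Finite Γ] (h : SS y p) {k l : ℕ} (hkl : k ≤ l) : mx p k ≤ mx p l := by
  obtain ⟨j, hj⟩ := h.mx_att k
  obtain ⟨d, rfl⟩ := Nat.exists_eq_add_of_le hkl
  have h1 := h.le_P_add d (p^[k] j) (len p k j)
  have h2 := Nat.le_mul_of_pos_right (len p k j) (h.mn_pos d)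
  rw [← h.len_spec, ← P_comp, ← P_comp, add_comm d k] at h1
  have h3 := h.le_mx (k+d) j
  have h4 := h.len_spec (k+d) j
  omega

lemma SS.mx_le [Finite Γ] (h : SS y p) : ∃ C, 1 ≤ C ∧ ∀ k, mx p k ≤ C * mn p k := by
  obtain ⟨q, hq⟩ := h.prim
  refine ⟨mx p q, (h.len_pos q 0).trans (h.le_mx q 0), fun k => ?_⟩
  by_cases hk : q ≤ k
  · obtain ⟨d, rfl⟩ := Nat.exists_eq_add_of_le' hk
    exact (h.mx_add d q).trans (Nat.mul_le_mul_left _ (h.mx_le_mn_of q hq d))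
  · exact (h.mx_mono (by omega : k ≤ q)).trans (Nat.le_mul_of_pos_right _ (h.mn_pos k))

lemma SS.mx_big [Finite Γ] (h : SS y p) (k : ℕ) : k + 1 ≤ p^[k] 1 := by
  induction k with
  | zero => simp
  | succ k ih =>
    have h1 : p^[k] 2 ≤ p^[k+1] 1 := by
      rw [Function.iterate_succ_apply]
      exact (h.monoP k).monotone h.p1
    have := h.monoP k (show 1 < 2 by norm_num)
    omega

lemma SS.mn_big [Finite Γ] (h : SS y p) (b : ℕ) : ∃ k0, ∀ k ≥ k0, b ≤ mn p k := by
  obtain ⟨C, hC, hh⟩ := h.mx_le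
  refine ⟨C * b, fun k hk => ?_⟩
  have h1 := h.mx_big k
  have h2 := h.le_mx k 0
  have h3 := h.len_spec k 0
  rw [h.P0] at h3
  have h4 := hh k
  have : C * b ≤ C * mn p k := by simp at h3; omega
  exact Nat.le_of_mul_le_mul_left this hC

/-- scale selection -/
lemma SS.scale [Finite Γ] (h : SS y p) : ∃ C, 1 ≤ C ∧ ∀ n ≥ 2, ∃ k, n ≤ mn p k ∧ mx p k ≤ C * n := by
  classical
  obtain ⟨C, hC, hh⟩ := h.mx_le
  refine ⟨mx p 1 * C, Nat.mul_pos ((h.len_pos 1 0).trans (h.le_mx 1 0)) hC, fun n hn => ?_⟩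
  have hex : ∃ k, n ≤ mn p k := by
    obtain ⟨k0, hk0⟩ := h.mn_big n
    exact ⟨k0, hk0 k0 le_rfl⟩
  refine ⟨Nat.find hex, Nat.find_spec hex, ?_⟩
  have hpos : Nat.find hex ≠ 0 := by
    intro h0
    have := Nat.find_spec hex
    rw [h0] at this
    have h2 := SS.mn_le (p := p) 0 0
    simp [len] at h2
    omega
  obtain ⟨k, hk⟩ := Nat.exists_eq_succ_of_ne_zero hpos
  have hlt := Nat.find_min hex (m := k) (by omega)
  rw [hk]
  calc mx p (k+1) ≤ mx p 1 * mx p k := h.mx_add k 1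
    _ ≤ mx p 1 * (C * mn p k) := Nat.mul_le_mul_left _ (hh k)
    _ ≤ mx p 1 * (C * n) := Nat.mul_le_mul_left _ (Nat.mul_le_mul_left _ (by omega))
    _ = _ := by ring

end Cob

namespace Cob
variable {Γ : Type*} {y : ℕ → Γ} {p : ℕ → ℕ}

/-- partial sums -/
noncomputable def Sm (e : ℕ → ℝ) (N : ℕ) : ℝ := ∑ i ∈ Finset.range N, e i

lemma Sm_add (e : ℕ → ℝ) (a l : ℕ) : Sm e (a + l) = Sm e a + ∑ t ∈ Finset.range l, e (a + t) := by
  unfold Sm; rw [Finset.sum_range_add]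

lemma Sm_mono {e : ℕ → ℝ} (he : ∀ i, 0 ≤ e i) : Monotone (Sm e) := by
  intro a b hab
  obtain ⟨d, rfl⟩ := Nat.exists_eq_add_of_le hab
  rw [Sm_add]
  have : 0 ≤ ∑ t ∈ Finset.range d, e (a + t) := Finset.sum_nonneg (fun i _ => he _)
  linarith

/-- block sum -/
noncomputable def bs (p : ℕ → ℕ) (e : ℕ → ℝ) (k j : ℕ) : ℝ := Sm e (p^[k] (j+1)) - Sm e (p^[k] j)

def Valid (p : ℕ → ℕ) (e : ℕ → ℝ) (k : ℕ) (α β : ℝ) : Prop :=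
  ∀ j, β * len p k j ≤ bs p e k j ∧ bs p e k j ≤ α * len p k j

lemma Valid.range (h : SS y p) {e : ℕ → ℝ} {k : ℕ} {α β : ℝ} (hv : Valid p e k α β) (a n : ℕ) :
    β * ((p^[k] (a+n) : ℝ) - p^[k] a) ≤ Sm e (p^[k] (a+n)) - Sm e (p^[k] a) ∧
    Sm e (p^[k] (a+n)) - Sm e (p^[k] a) ≤ α * ((p^[k] (a+n) : ℝ) - p^[k] a) := by
  induction n with
  | zero => simp
  | succ n ih =>
    have h1 := hv (a+n)
    have h2 := h.len_spec k (a+n)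
    unfold bs at h1
    have h3 : (p^[k] (a+n+1) : ℝ) = p^[k] (a+n) + len p k (a+n) := by exact_mod_cast h2
    rw [← add_assoc, h3]
    constructor
    · nlinarith [ih.1, h1.1]
    · nlinarith [ih.2, h1.2]

lemma Valid.range' (h : SS y p) {e : ℕ → ℝ} {k : ℕ} {α β : ℝ} (hv : Valid p e k α β) {a b : ℕ} (hab : a ≤ b) :
    β * ((p^[k] b : ℝ) - p^[k] a) ≤ Sm e (p^[k] b) - Sm e (p^[k] a) ∧
    Sm e (p^[k] b) - Sm e (p^[k] a) ≤ α * ((p^[k] b : ℝ) - p^[k] a) := by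
  obtain ⟨d, rfl⟩ := Nat.exists_eq_add_of_le hab
  exact hv.range h a d

lemma len_cast (h : SS y p) (k j : ℕ) : (len p k j : ℝ) = (p^[k] (j+1) : ℝ) - p^[k] j := by
  have := h.len_spec k j
  rw [this]; push_cast; ring

lemma Valid.up (h : SS y p) {e : ℕ → ℝ} {k : ℕ} {α β : ℝ} (hv : Valid p e k α β) (d : ℕ) :
    Valid p e (k+d) α β := by
  intro j
  rw [len_cast h]
  unfold bs
  simp only [P_comp]
  exact hv.range' h ((h.monoP d).monotone (Nat.le_succ j))

lemma bs_close (h : SS y p) {e : ℕ → ℝ} {Hb : ℝ} (he0 : ∀ i, 0 ≤ e i) (heH : ∀ i, e i ≤ Hb) {n0 : ℕ}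
    (hl : ∀ i j, Agree y n0 i j → e i = e j) (k i j : ℕ) (hij : y i = y j) :
    bs p e k i ≤ bs p e k j + n0 * Hb := by
  obtain ⟨h1, h2⟩ := h.len_eq k i j hij
  unfold bs
  rw [h.len_spec, h.len_spec, Sm_add, Sm_add, ← h1]
  have hH : 0 ≤ Hb := (he0 0).trans (heH 0)
  set l := len p k i
  have key : ∑ t ∈ Finset.range l, (e (p^[k] i + t) - e (p^[k] j + t)) ≤ n0 * Hb := by
    calc ∑ t ∈ Finset.range l, (e (p^[k] i + t) - e (p^[k] j + t))
        ≤ ∑ t ∈ Finset.range l, (if l - n0 ≤ t then Hb else 0) := by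
          apply Finset.sum_le_sum
          intro t ht
          split_ifs with hc
          · linarith [heH (p^[k] i + t), he0 (p^[k] j + t)]
          · rw [hl (p^[k] i + t) (p^[k] j + t)]
            · simp
            · intro s hs
              have := h2 (t+s) (by omega)
              simpa [add_assoc] using this
      _ = ((Finset.range l).filter (fun t => l - n0 ≤ t)).card * Hb := by
          rw [← Finset.sum_filter]; simp
      _ ≤ n0 * Hb := by
          apply mul_le_mul_of_nonneg_right _ hH
          have : (Finset.range l).filter (fun t => l - n0 ≤ t) ⊆ Finset.Ico (l - n0) l := by
            intro t; simp; omega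
          have := Finset.card_le_card this
          rw [Nat.card_Ico] at this
          exact_mod_cast this.trans (by omega)
  rw [Finset.sum_sub_distrib] at key
  linarith

lemma mean_step [Finite Γ] (h : SS y p) {e : ℕ → ℝ} {Hb : ℝ} (he0 : ∀ i, 0 ≤ e i) (heH : ∀ i, e i ≤ Hb) {n0 : ℕ}
    (hl : ∀ i j, Agree y n0 i j → e i = e j) :
    ∃ δ : ℝ, 0 < δ ∧ δ < 1 ∧ ∀ k α β, β < α → Valid p e k α β →
      ∃ k' α' β', β' ≤ α' ∧ Valid p e k' α' β' ∧ α' - β' = (1 - δ) * (α - β) := by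
  obtain ⟨C, hC, hh⟩ := h.mx_le
  obtain ⟨q, hq⟩ := h.prim
  have hCq : 1 ≤ mx p q := (h.len_pos q 0).trans (h.le_mx q 0)
  set D : ℝ := mx p q * C with hD
  have hD1 : 1 ≤ D := by
    have : 1 ≤ mx p q * C := Nat.mul_pos hCq hC
    rw [hD]; exact_mod_cast this
  have hHb : 0 ≤ Hb := (he0 0).trans (heH 0)
  refine ⟨1 / (4 * D), by positivity, by rw [div_lt_one (by positivity)]; linarith, ?_⟩
  intro k0 α β hαβ hv0
  obtain ⟨k1, hk1⟩ := h.mn_big (⌈4 * (n0 * Hb) / (α - β)⌉₊)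
  have hv := hv0.up h k1
  set k := k0 + k1
  have hmk : 4 * (n0 * Hb) / (α - β) ≤ mn p k := by
    refine (Nat.le_ceil _).trans ?_
    exact_mod_cast hk1 k (by omega)
  have hg : 0 < α - β := by linarith
  rw [div_le_iff₀ hg] at hmk
  -- structural: every big block contains a copy of block 0
  have hstr : ∀ j, ∃ i, p^[q] j ≤ i ∧ i + 1 ≤ p^[q] (j+1) ∧ y i = y 0 := fun j => hq j (y 0)
  have hlen : ∀ j i, (len p (k+q) j : ℝ) ≤ D * len p k i := by
    intro j i
    have a1 := h.le_mx (k+q) j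
    have a2 := h.mx_add k q
    have a3 := Nat.mul_le_mul_left (mx p q) ((hh k).trans (Nat.mul_le_mul_left C (SS.mn_le (p := p) k i)))
    have : len p (k+q) j ≤ mx p q * (C * len p k i) := a1.trans (a2.trans a3)
    rw [hD, mul_assoc]; exact_mod_cast this
  have hδ : ∀ j i, (1 / (4 * D) * (α - β)) * len p (k+q) j ≤ (α - β) / 4 * len p k i := by
    intro j i
    have := mul_le_mul_of_nonneg_left (hlen j i) (show 0 ≤ 1 / (4 * D) * (α - β) by positivity)
    refine this.trans (le_of_eq ?_)
    field_simp
  have hsmall : ∀ i, n0 * Hb ≤ (α - β) / 4 * len p k i := by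
    intro i
    have : (mn p k : ℝ) ≤ len p k i := by exact_mod_cast SS.mn_le (p := p) k i
    nlinarith
  have hdlt : 1 / (4 * D) * (α - β) ≤ α - β := by
    have : 1 / (4 * D) ≤ 1 := by rw [div_le_one (by positivity)]; linarith
    nlinarith
  rcases le_total (bs p e k 0) ((α + β) / 2 * len p k 0) with hc | hc
  · refine ⟨k + q, α - 1 / (4 * D) * (α - β), β, by linarith, ?_, by ring⟩
    intro j
    refine ⟨(hv.up h q j).1, ?_⟩
    obtain ⟨i, hi1, hi2, hi3⟩ := hstr j
    have r1 := (hv.range' h hi1).2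
    have r2 := (hv.range' h hi2).2
    have r3 := bs_close h he0 heH hl k i 0 hi3
    have r4 := hδ j i
    have r5 := hsmall i
    rw [← (h.len_eq k i 0 hi3).1] at hc
    have r6 := len_cast h k i
    have r7 := len_cast h (k+q) j
    simp only [P_comp] at r7
    have r8 : bs p e (k+q) j = Sm e (p^[k] (p^[q] (j+1))) - Sm e (p^[k] (p^[q] j)) := by
      unfold bs; simp only [P_comp]
    unfold bs at r3 hc
    have r9 : bs p e k i = Sm e (p^[k] (i+1)) - Sm e (p^[k] i) := rfl
    rw [r8]
    have e1 : (α - 1 / (4 * D) * (α - β)) * len p (k+q) j = α * len p (k+q) j - (1 / (4 * D) * (α - β)) * len p (k+q) j := by ring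
    rw [e1]
    have e2 : α * (len p (k+q) j : ℝ) = α * ((p^[k] (p^[q] (j+1)) : ℝ) - p^[k] (i+1)) + α * len p k i + α * ((p^[k] i : ℝ) - p^[k] (p^[q] j)) := by
      rw [r6, r7]; ring
    rw [e2]
    nlinarith
  · refine ⟨k + q, α, β + 1 / (4 * D) * (α - β), by linarith, ?_, by ring⟩
    intro j
    refine ⟨?_, (hv.up h q j).2⟩
    obtain ⟨i, hi1, hi2, hi3⟩ := hstr j
    have r1 := (hv.range' h hi1).1
    have r2 := (hv.range' h hi2).1
    have r3 := bs_close h he0 heH hl k 0 i hi3.symm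
    have r4 := hδ j i
    have r5 := hsmall i
    rw [← (h.len_eq k i 0 hi3).1] at hc
    have r6 := len_cast h k i
    have r7 := len_cast h (k+q) j
    simp only [P_comp] at r7
    have r8 : bs p e (k+q) j = Sm e (p^[k] (p^[q] (j+1))) - Sm e (p^[k] (p^[q] j)) := by
      unfold bs; simp only [P_comp]
    unfold bs at r3 hc
    rw [r8]
    have e1 : (β + 1 / (4 * D) * (α - β)) * len p (k+q) j = β * len p (k+q) j + (1 / (4 * D) * (α - β)) * len p (k+q) j := by ring
    rw [e1]
    have e2 : β * (len p (k+q) j : ℝ) = β * ((p^[k] (p^[q] (j+1)) : ℝ) - p^[k] (i+1)) + β * len p k i + β * ((p^[k] i : ℝ) - p^[k] (p^[q] j)) := by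
      rw [r6, r7]; ring
    rw [e2]
    nlinarith

lemma valid_init (h : SS y p) {e : ℕ → ℝ} {Hb : ℝ} (he0 : ∀ i, 0 ≤ e i) (heH : ∀ i, e i ≤ Hb) :
    Valid p e 0 Hb 0 := by
  intro j
  have : len p 0 j = 1 := by simp [len]
  rw [this]
  have : bs p e 0 j = e j := by simp [bs, Sm, Finset.sum_range_succ]
  rw [this]
  simpa using ⟨he0 j, heH j⟩

lemma valid_small [Finite Γ] (h : SS y p) {e : ℕ → ℝ} {Hb : ℝ} (he0 : ∀ i, 0 ≤ e i) (heH : ∀ i, e i ≤ Hb) {n0 : ℕ}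
    (hl : ∀ i j, Agree y n0 i j → e i = e j) (ε : ℝ) (hε : 0 < ε) :
    ∃ k α β, Valid p e k α β ∧ α - β < ε := by
  obtain ⟨δ, hδ0, hδ1, hs⟩ := mean_step h he0 heH hl
  have hHb : 0 ≤ Hb := (he0 0).trans (heH 0)
  by_contra hcon
  push Not at hcon
  have key : ∀ n : ℕ, ∃ k α β, Valid p e k α β ∧ α - β ≤ (1 - δ)^n * Hb := by
    intro n
    induction n with
    | zero => exact ⟨0, Hb, 0, valid_init h he0 heH, by simp⟩
    | succ n ih =>
      obtain ⟨k, α, β, hv, hle⟩ := ih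
      have := hcon k α β hv
      obtain ⟨k', α', β', -, hv', he⟩ := hs k α β (by linarith) hv
      refine ⟨k', α', β', hv', ?_⟩
      rw [he, pow_succ]
      nlinarith
  have ht : Tendsto (fun n : ℕ => (1 - δ)^n * Hb) atTop (𝓝 (0 * Hb)) :=
    (tendsto_pow_atTop_nhds_zero_of_lt_one (by linarith) (by linarith)).mul_const _
  rw [zero_mul] at ht
  obtain ⟨n, hn⟩ := (ht.eventually (gt_mem_nhds hε)).exists
  obtain ⟨k, α, β, hv, hle⟩ := key n
  linarith [hcon k α β hv]

lemma exists_block [Finite Γ] (h : SS y p) (k N : ℕ) : ∃ M, p^[k] M ≤ N ∧ N < p^[k] (M+1) := by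
  classical
  have hex : ∃ M, N < p^[k] (M+1) := ⟨N, (Nat.lt_succ_self N).trans_le ((h.monoP k).id_le (N+1))⟩
  refine ⟨Nat.find hex, ?_, Nat.find_spec hex⟩
  rcases Nat.eq_zero_or_pos (Nat.find hex) with h0 | h0
  · rw [h0, h.P0]; omega
  · have := Nat.find_min hex (m := Nat.find hex - 1) (by omega)
    rw [Nat.sub_add_cancel h0] at this
    omega

lemma Valid.all [Finite Γ] (h : SS y p) {e : ℕ → ℝ} (he0 : ∀ i, 0 ≤ e i) {k : ℕ} {α β : ℝ}
    (hv : Valid p e k α β) : ∃ K : ℝ, ∀ N : ℕ, β * N - K ≤ Sm e N ∧ Sm e N ≤ α * N + K := by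
  refine ⟨(|α| + |β|) * mx p k, fun N => ?_⟩
  obtain ⟨M, h1, h2⟩ := exists_block h k N
  have a1 := (hv.range' h (Nat.zero_le M)).1
  have a2 := (hv.range' h (Nat.zero_le (M+1))).2
  have b1 := Sm_mono he0 h1
  have b2 := Sm_mono he0 h2.le
  have c1 := h.len_spec k M
  have c2 := h.le_mx k M
  have d1 : (N : ℝ) - p^[k] M ≤ mx p k := by
    have : N ≤ p^[k] M + mx p k := by omega
    have : (N : ℝ) ≤ p^[k] M + mx p k := by exact_mod_cast this
    linarith
  have d1' : 0 ≤ (N : ℝ) - p^[k] M := by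
    have : (p^[k] M : ℝ) ≤ N := by exact_mod_cast h1
    linarith
  have d2 : (p^[k] (M+1) : ℝ) - N ≤ mx p k := by
    have : p^[k] (M+1) ≤ N + mx p k := by omega
    have : (p^[k] (M+1) : ℝ) ≤ N + mx p k := by exact_mod_cast this
    linarith
  have d2' : 0 ≤ (p^[k] (M+1) : ℝ) - N := by
    have : (N : ℝ) ≤ p^[k] (M+1) := by exact_mod_cast h2.le
    linarith
  have z : Sm e 0 = 0 := by simp [Sm]
  simp only [h.P0, z, Nat.cast_zero, sub_zero] at a1 a2
  have f1 : β * ((N : ℝ) - p^[k] M) ≤ |β| * mx p k :=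
    (mul_le_mul_of_nonneg_right (le_abs_self β) d1').trans (mul_le_mul_of_nonneg_left d1 (abs_nonneg _))
  have f2 : α * ((p^[k] (M+1) : ℝ) - N) ≤ |α| * mx p k :=
    (mul_le_mul_of_nonneg_right (le_abs_self α) d2').trans (mul_le_mul_of_nonneg_left d2 (abs_nonneg _))
  have g1 : 0 ≤ |α| * mx p k := by positivity
  have g2 : 0 ≤ |β| * mx p k := by positivity
  constructor <;> nlinarith

theorem mean [Finite Γ] (h : SS y p) {e : ℕ → ℝ} {Hb : ℝ} (he0 : ∀ i, 0 ≤ e i) (heH : ∀ i, e i ≤ Hb) {n0 : ℕ}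
    (hl : ∀ i j, Agree y n0 i j → e i = e j) :
    ∃ s, Tendsto (fun N : ℕ => Sm e N / N) atTop (𝓝 s) := by
  apply cauchySeq_tendsto_of_complete
  rw [Metric.cauchySeq_iff']
  intro ε hε
  obtain ⟨k, α, β, hv, hlt⟩ := valid_small h he0 heH hl (ε/2) (by positivity)
  obtain ⟨K, hK⟩ := hv.all h he0
  obtain ⟨N0, hN0⟩ := exists_nat_gt (max 0 (K / (ε/4)))
  have hN0pos : (0:ℝ) < N0 := (le_max_left _ _).trans_lt hN0
  have hb : ∀ N ≥ N0, β - ε/4 < Sm e N / N ∧ Sm e N / N < α + ε/4 := by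
    intro N hN
    have hN' : (N0 : ℝ) ≤ N := by exact_mod_cast hN
    have hNpos : (0:ℝ) < N := by linarith
    have : K / (ε/4) < N := ((le_max_right _ _).trans_lt hN0).trans_le hN'
    rw [div_lt_iff₀ (by positivity)] at this
    have := hK N
    rw [lt_div_iff₀ hNpos, div_lt_iff₀ hNpos]
    constructor <;> nlinarith
  refine ⟨N0, fun N hN => ?_⟩
  have h1 := hb N hN
  have h2 := hb N0 le_rfl
  rw [Real.dist_eq, abs_lt]
  constructor <;> linarith

lemma SS.tendstoP (h : SS y p) (k : ℕ) : Tendsto (p^[k]) atTop atTop := (h.monoP k).tendsto_atTop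

theorem mean_pos [Finite Γ] (h : SS y p) {e : ℕ → ℝ} (he0 : ∀ i, 0 ≤ e i) {n0 : ℕ}
    (hl : ∀ i j, Agree y n0 i j → e i = e j) {s : ℝ}
    (hs : Tendsto (fun N : ℕ => Sm e N / N) atTop (𝓝 s)) (i0 : ℕ) (hi0 : 0 < e i0) : 0 < s := by
  obtain ⟨q, hq⟩ := h.prim
  set k := i0 + n0
  have hk := h.mx_big k
  have hblk : ∀ j, e i0 ≤ bs p e (k+q) j := by
    intro j
    obtain ⟨i, h1, h2, h3⟩ := hq j (y 0)
    obtain ⟨b1, b2⟩ := h.len_eq k i 0 h3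
    have b3 := h.len_spec k 0
    rw [h.P0] at b3
    simp only [zero_add] at b3
    have he : e (p^[k] i + i0) = e i0 := by
      apply hl
      intro t ht
      have := b2 (i0 + t) (by omega)
      rw [h.P0] at this
      simpa [add_assoc] using this
    rw [← he]
    unfold bs
    simp only [P_comp]
    have c1 := (h.monoP k).monotone h1
    have c2 := (h.monoP k).monotone (Nat.succ_le_of_lt h2)
    have c3 := h.len_spec k i
    have d1 := Sm_mono he0 c1
    have d2 := Sm_mono he0 (show p^[k] i + i0 + 1 ≤ p^[k] (p^[q] (j+1)) by
      simp only [Nat.succ_eq_add_one] at c2; omega)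
    have d3 := Sm_mono he0 (show p^[k] i ≤ p^[k] i + i0 by omega)
    have d4 : Sm e (p^[k] i + i0 + 1) = Sm e (p^[k] i + i0) + e (p^[k] i + i0) := by
      unfold Sm; rw [Finset.sum_range_succ]
    linarith
  have hsum : ∀ M : ℕ, M * e i0 ≤ Sm e (p^[k+q] M) := by
    intro M
    induction M with
    | zero => simp [h.P0, Sm]
    | succ M ih =>
      have := hblk M
      unfold bs at this
      push_cast
      linarith
  have hX : (0:ℝ) < mx p (k+q) := by exact_mod_cast (h.len_pos (k+q) 0).trans (h.le_mx (k+q) 0)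
  have hlim := hs.comp (h.tendstoP (k+q))
  refine lt_of_lt_of_le (div_pos hi0 hX) (ge_of_tendsto hlim ?_)
  filter_upwards [eventually_ge_atTop 1] with M hM
  have h1 := h.P_le (k+q) M
  have h2 : (p^[k+q] M : ℝ) ≤ M * mx p (k+q) := by exact_mod_cast h1
  have h3 : (0:ℝ) < p^[k+q] M := by
    have := (h.monoP (k+q)).id_le M
    simp only [id] at this
    exact_mod_cast (by omega : 0 < p^[k+q] M)
  simp only [Function.comp]
  rw [div_le_div_iff₀ hX h3]
  have := hsum M
  nlinarith

end Cob

namespace Cob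
variable {Γ : Type*} {y : ℕ → Γ} {p : ℕ → ℕ}

def Occ {S : Type*} (x : ℕ → S) (n i : ℕ) : Prop := ∀ t < n, x (i + t) = x t

open Classical in
noncomputable def ind {S : Type*} (x : ℕ → S) (n i : ℕ) : ℝ := if Occ x n i then 1 else 0

lemma ind_nonneg {S : Type*} (x : ℕ → S) (n i : ℕ) : 0 ≤ ind x n i := by
  unfold ind; split_ifs <;> norm_num
lemma ind_le {S : Type*} (x : ℕ → S) (n i : ℕ) : ind x n i ≤ 1 := by
  unfold ind; split_ifs <;> norm_num

/-- pairs of letters reoccur early -/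
lemma pairs_early [Finite Γ] (y : ℕ → Γ) : ∃ R, ∀ j, ∃ j' ≤ R, Agree y 2 j j' := by
  classical
  let F : Γ × Γ → ℕ := fun ab => if h : ∃ j, y j = ab.1 ∧ y (j+1) = ab.2 then h.choose else 0
  obtain ⟨R, hR⟩ := (Set.finite_range F).bddAbove
  refine ⟨R, fun j => ⟨F (y j, y (j+1)), hR ⟨_, rfl⟩, ?_⟩⟩
  have hj : ∃ j', y j' = (y j, y (j+1)).1 ∧ y (j'+1) = (y j, y (j+1)).2 := ⟨j, rfl, rfl⟩
  have : F (y j, y (j+1)) = hj.choose := by simp only [F, dif_pos hj]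
  rw [this]
  intro t ht
  interval_cases t
  · simpa using hj.choose_spec.1.symm
  · simpa using hj.choose_spec.2.symm

lemma gap [Finite Γ] (h : SS y p) {S : Type*} (τ : Γ → S)
    (hn : ¬ ∃ r > 0, ∀ i : ℕ, τ (y (i + r)) = τ (y i)) :
    ∃ K, 1 ≤ K ∧ ∀ n i r, 0 < r → Occ (fun i => τ (y i)) n i → Occ (fun i => τ (y i)) n (i+r) → n ≤ K * r := by
  obtain ⟨C, hC, hsc⟩ := h.scale
  obtain ⟨R, hR⟩ := pairs_early y
  refine ⟨(R+2) * C * 2, by nlinarith, fun n i r hr h1 h2 => ?_⟩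
  by_contra hlt
  push Not at hlt
  apply hn
  refine ⟨r, hr, fun s => ?_⟩
  obtain ⟨k, hk1, hk2⟩ := hsc (r+1) (by omega)
  obtain ⟨j, hj1, hj2⟩ := exists_block h k s
  obtain ⟨j', hj', hag⟩ := hR j
  obtain ⟨l, e1, e2, e3⟩ := h.agreeP k 2 j j' hag
  have a1 := h.len_spec k j
  have a2 := h.len_spec k (j+1)
  have a3 := SS.mn_le (p := p) k (j+1)
  have a4 := h.P_le k (j'+2)
  have a5 : (j'+2) * mx p k ≤ (R+2) * (C * (2 * r)) := by
    apply Nat.mul_le_mul (by omega)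
    exact hk2.trans (Nat.mul_le_mul_left _ (by omega))
  have a6 : (R+2) * (C * (2 * r)) = (R+2) * C * 2 * r := by ring
  have e1' : p^[k] (j+1+1) = p^[k] j + l := e1
  obtain ⟨d, hd⟩ := Nat.exists_eq_add_of_le hj1
  have b1 := e3 d (by omega)
  have b2 := e3 (d + r) (by omega)
  rw [hd, add_assoc, b1, b2]
  have c1 := h2 (p^[k] j' + d) (by omega)
  have c2 := h1 (r + (p^[k] j' + d)) (by omega)
  simp only at c1 c2
  rw [← c1, add_assoc i r, c2]
  congr 2; ring

lemma count_bound {S : Type*} {x : ℕ → S} {K n : ℕ} (hn : 0 < n)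
    (hg : ∀ i r, 0 < r → Occ x n i → Occ x n (i+r) → n ≤ K * r) (a l : ℕ) :
    ∃ c : ℕ, ∑ t ∈ Finset.range l, ind x n (a + t) = c ∧ c ≤ K * l / n + 2 := by
  classical
  refine ⟨((Finset.range l).filter (fun t => Occ x n (a+t))).card, ?_, ?_⟩
  · unfold ind
    rw [← Finset.sum_filter]
    simp only [Finset.sum_const, nsmul_eq_mul, mul_one]
  · have : ((Finset.range l).filter (fun t => Occ x n (a+t))).card ≤ (Finset.range (K * l / n + 1)).card := by
      apply Finset.card_le_card_of_injOn (fun t => K * t / n)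
      · intro t ht
        simp only [Finset.coe_filter, Finset.mem_range, Set.mem_ofPred_eq] at ht
        simp only [Finset.coe_range, Set.mem_Iio]
        exact Nat.lt_succ_of_le (Nat.div_le_div_right (Nat.mul_le_mul_left _ ht.1.le))
      · have key : ∀ t t', t < t' → Occ x n (a+t) → Occ x n (a+t') → K * t / n < K * t' / n := by
          intro t t' htt h1 h2
          obtain ⟨r, rfl⟩ := Nat.exists_eq_add_of_lt htt
          have := hg (a+t) (r+1) (by omega) h1 (by convert h2 using 1; ring)
          have h3 : K * t + n ≤ K * (t + r + 1) := by nlinarith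
          have h4 := Nat.div_le_div_right (c := n) h3
          rw [Nat.add_div_right _ hn] at h4
          omega
        intro t ht t' ht' heq
        simp only [Finset.coe_filter, Finset.mem_range, Set.mem_ofPred_eq] at ht ht'
        simp only at heq
        rcases lt_trichotomy t t' with hlt | hlt | hlt
        · have := key t t' hlt ht.2 ht'.2; omega
        · exact hlt
        · have := key t' t hlt ht'.2 ht.2; omega
    rw [Finset.card_range] at this
    omega

lemma Sm_ratio {e : ℕ → ℝ} {s Λ : ℝ} (hs : Tendsto (fun N : ℕ => Sm e N / N) atTop (𝓝 s))
    {P : ℕ → ℕ} (hP : StrictMono P) (hΛ : Tendsto (fun M : ℕ => (P M : ℝ) / M) atTop (𝓝 Λ)) :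
    Tendsto (fun M : ℕ => Sm e (P M) / M) atTop (𝓝 (s * Λ)) := by
  refine ((hs.comp hP.tendsto_atTop).mul hΛ).congr' ?_
  filter_upwards [eventually_ge_atTop 1] with M hM
  have := hP.id_le M
  simp only [id] at this
  have h3 : (P M : ℝ) ≠ 0 := by exact_mod_cast (by omega : P M ≠ 0)
  simp only [Function.comp]
  field_simp

lemma Sm_one (N : ℕ) : Sm (fun _ => 1) N = N := by simp [Sm]

lemma pow_rate (h : SS y p) {Λ : ℝ} (hΛ : Tendsto (fun M : ℕ => (p M : ℝ) / M) atTop (𝓝 Λ)) (k : ℕ) :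
    Tendsto (fun M : ℕ => (p^[k] M : ℝ) / M) atTop (𝓝 (Λ^k)) := by
  induction k with
  | zero =>
    simp only [Function.iterate_zero, id, pow_zero]
    refine tendsto_const_nhds.congr' ?_
    filter_upwards [eventually_ge_atTop 1] with M hM
    have : (M : ℝ) ≠ 0 := by exact_mod_cast (by omega : M ≠ 0)
    field_simp
  | succ k ih =>
    have := ((hΛ.comp (h.tendstoP k)).mul ih)
    rw [pow_succ, mul_comm]
    refine this.congr' ?_
    filter_upwards [eventually_ge_atTop 1] with M hM
    have := (h.monoP k).id_le M
    simp only [id] at this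
    have h3 : (p^[k] M : ℝ) ≠ 0 := by exact_mod_cast (by omega : p^[k] M ≠ 0)
    simp only [Function.comp, Function.iterate_succ_apply']
    field_simp

lemma rate_exists [Finite Γ] (h : SS y p) : ∃ Λ : ℝ, 1 ≤ Λ ∧ Tendsto (fun M : ℕ => (p M : ℝ) / M) atTop (𝓝 Λ) := by
  obtain ⟨s, hs⟩ := mean h (e := fun j => (len p 1 j : ℝ)) (Hb := mx p 1) (n0 := 1) (fun i => by positivity)
    (fun i => by exact_mod_cast h.le_mx 1 i) (fun i j hij => by
      have := (h.len_eq 1 i j (by simpa using hij 0 (by norm_num))).1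
      simp only [this])
  have hS : ∀ M, Sm (fun j => (len p 1 j : ℝ)) M = p M := by
    intro M
    induction M with
    | zero => simp [Sm, h.p0]
    | succ M ih =>
      have := h.len_spec 1 M
      simp only [Function.iterate_one] at this
      unfold Sm at ih ⊢
      rw [Finset.sum_range_succ, ih, this]; push_cast; ring
  simp only [hS] at hs
  refine ⟨s, ge_of_tendsto hs ?_, hs⟩
  filter_upwards [eventually_ge_atTop 1] with M hM
  have h1 := h.mono.id_le M
  simp only [id] at h1
  rw [le_div_iff₀ (by exact_mod_cast hM), one_mul]
  exact_mod_cast h1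

theorem main_one [Finite Γ] (h : SS y p) {S : Type*} (τ : Γ → S)
    (hn : ¬ ∃ r > 0, ∀ i : ℕ, τ (y (i + r)) = τ (y i)) {Λ : ℝ}
    (hΛ : Tendsto (fun M : ℕ => (p M : ℝ) / M) atTop (𝓝 Λ)) :
    ∃ (F : Set ℝ) (K : ℝ), F.Finite ∧ ∀ n ≥ 2, ∃ s : ℝ,
      Tendsto (fun N : ℕ => Sm (ind (fun i => τ (y i)) n) N / N) atTop (𝓝 s) ∧ 0 < s ∧ s ≤ K / n ∧
      ∃ k : ℕ, s * Λ^k ∈ F := by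
  classical
  obtain ⟨K, hK1, hK⟩ := gap h τ hn
  obtain ⟨C, hC, hsc⟩ := h.scale
  set B := K * C + 2 with hB
  set x : ℕ → S := fun i => τ (y i) with hx
  have hex : ∀ o : Γ × Γ → Fin (B+1), ∃ s : ℝ,
      Tendsto (fun N : ℕ => Sm (fun j => ((o (y j, y (j+1)) : ℕ) : ℝ)) N / N) atTop (𝓝 s) := by
    intro o
    refine mean h (Hb := B) (n0 := 2) (fun i => by positivity) (fun i => ?_) (fun i j hij => ?_)
    · exact_mod_cast Nat.lt_succ_iff.mp (o (y i, y (i+1))).2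
    · have h0 := hij 0 (by norm_num)
      have h1 := hij 1 (by norm_num)
      simp only [add_zero] at h0
      simp only [h0, h1]
  choose Φ hΦ using hex
  refine ⟨Set.range Φ, K, Set.finite_range Φ, fun n hn2 => ?_⟩
  have hloc : ∀ i j, Agree y n i j → ind x n i = ind x n j := by
    intro i j hij
    have : Occ x n i ↔ Occ x n j := by
      unfold Occ
      refine forall₂_congr fun t ht => ?_
      simp only [hx, hij t ht]
    unfold ind
    simp only [this]
  obtain ⟨s, hs⟩ := mean h (ind_nonneg x n) (ind_le x n) hloc
  have hcb := count_bound (x := x) (K := K) (n := n) (by omega) (fun i r => hK n i r)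
  have hnpos : (0:ℝ) < n := by exact_mod_cast (by omega : 0 < n)
  refine ⟨s, hs, ?_, ?_, ?_⟩
  · refine mean_pos h (ind_nonneg x n) hloc hs 0 ?_
    have : Occ x n 0 := fun t _ => by simp
    simp [ind, this]
  · have hlim : Tendsto (fun N : ℕ => (K / n : ℝ) + 2 * (1 / (N:ℝ))) atTop (𝓝 (K / n + 2 * 0)) :=
      tendsto_const_nhds.add (tendsto_one_div_atTop_nhds_zero_nat.const_mul 2)
    rw [mul_zero, add_zero] at hlim
    refine le_of_tendsto_of_tendsto hs hlim ?_
    filter_upwards [eventually_ge_atTop 1] with N hN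
    obtain ⟨c, hc1, hc2⟩ := hcb 0 N
    have hSN : Sm (ind x n) N = c := by rw [← hc1]; simp [Sm]
    rw [hSN]
    have hNpos : (0:ℝ) < N := by exact_mod_cast hN
    have h1 : (c:ℝ) ≤ ((K * N / n : ℕ) : ℝ) + 2 := by exact_mod_cast hc2
    have h2 : ((K * N / n : ℕ) : ℝ) ≤ ((K * N : ℕ) : ℝ) / n := Nat.cast_div_le
    push_cast at h2
    rw [div_le_iff₀ hNpos]
    calc (c:ℝ) ≤ K * N / n + 2 := by linarith
      _ = _ := by field_simp
  · obtain ⟨k, hk1, hk2⟩ := hsc n hn2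
    have hbl : ∀ j, ∃ c : ℕ, bs p (ind x n) k j = c ∧ c < B + 1 := by
      intro j
      obtain ⟨c, hc1, hc2⟩ := hcb (p^[k] j) (len p k j)
      refine ⟨c, ?_, ?_⟩
      · unfold bs
        rw [h.len_spec, Sm_add, hc1]; ring
      · have h1 : K * len p k j ≤ K * C * n := by
          rw [mul_assoc]; exact Nat.mul_le_mul_left _ ((h.le_mx k j).trans hk2)
        have h2 := Nat.div_le_div_right (c := n) h1
        rw [Nat.mul_div_cancel _ (by omega)] at h2
        omega
    choose c hc1 hc2 using hbl
    have hcloc : ∀ i j, Agree y 2 i j → c i = c j := by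
      intro i j hij
      have : bs p (ind x n) k i = bs p (ind x n) k j := by
        obtain ⟨l, e1, e2, e3⟩ := h.agreeP k 2 i j hij
        have a1 := h.len_spec k i
        have a2 := h.len_spec k (i+1)
        have a3 := SS.mn_le (p := p) k (i+1)
        have a4 := (h.len_eq k i j (by simpa using hij 0 (by norm_num))).1
        have e1' : p^[k] (i+1+1) = p^[k] i + l := e1
        unfold bs
        rw [h.len_spec, h.len_spec, Sm_add, Sm_add, ← a4]
        have : ∑ t ∈ Finset.range (len p k i), ind x n (p^[k] i + t) = ∑ t ∈ Finset.range (len p k i), ind x n (p^[k] j + t) := by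
          apply Finset.sum_congr rfl
          intro t ht
          rw [Finset.mem_range] at ht
          apply hloc
          intro u hu
          have := e3 (t+u) (by omega)
          simpa [add_assoc] using this
        rw [this]; ring
      rw [hc1, hc1] at this
      exact_mod_cast this
    let o : Γ × Γ → Fin (B+1) := fun ab =>
      if hh : ∃ j, y j = ab.1 ∧ y (j+1) = ab.2 then ⟨c hh.choose, hc2 _⟩ else 0
    have ho : ∀ j, (o (y j, y (j+1)) : ℕ) = c j := by
      intro j
      have hj : ∃ j', y j' = (y j, y (j+1)).1 ∧ y (j'+1) = (y j, y (j+1)).2 := ⟨j, rfl, rfl⟩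
      simp only [o, dif_pos hj]
      apply hcloc
      intro t ht
      interval_cases t
      · simpa using hj.choose_spec.1
      · simpa using hj.choose_spec.2
    refine ⟨k, o, ?_⟩
    have t1 := Sm_ratio hs (h.monoP k) (pow_rate h hΛ k)
    refine tendsto_nhds_unique (hΦ o) (t1.congr fun M => ?_)
    congr 1
    simp only [ho]
    induction M with
    | zero => simp [Sm, h.P0]
    | succ M ih =>
      have h1 : Sm (fun j => (c j : ℝ)) (M+1) = Sm (fun j => (c j : ℝ)) M + c M := by
        unfold Sm; rw [Finset.sum_range_succ]
      rw [h1, ← ih, ← hc1]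
      unfold bs; ring

theorem final {φ : ℕ → ℝ} {a b K : ℝ} {F G : Set ℝ} (ha : 1 ≤ a) (hb : 1 ≤ b) (hF : F.Finite) (hG : G.Finite)
    (h : ∀ n ≥ 2, 0 < φ n ∧ φ n ≤ K / n ∧ (∃ k : ℕ, φ n * a^k ∈ F) ∧ ∃ m : ℕ, φ n * b^m ∈ G) :
    ∃ k m : ℕ, 1 ≤ k ∧ 1 ≤ m ∧ a^k = b^m := by
  classical
  choose h1 h2 h3 h4 using h
  choose k hk using h3
  choose m hm using h4
  have := hF.to_subtype
  have := hG.to_subtype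
  let f : ℕ → F × G := fun n => (⟨_, hk (n+2) (by omega)⟩, ⟨_, hm (n+2) (by omega)⟩)
  obtain ⟨⟨c, d⟩, hinf⟩ := Finite.exists_infinite_fiber f
  have hinf := Set.infinite_coe_iff.mp hinf
  obtain ⟨n1, hn1⟩ := hinf.nonempty
  have hp1 := h1 (n1+2) (by omega)
  obtain ⟨N, hN⟩ := exists_nat_gt (K / φ (n1+2))
  obtain ⟨n2, hn2, hlt⟩ := hinf.exists_gt N
  have hp2 := h1 (n2+2) (by omega)
  have hb2 := h2 (n2+2) (by omega)
  have hless : φ (n2+2) < φ (n1+2) := by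
    refine hb2.trans_lt ?_
    rw [div_lt_iff₀ hp1] at hN
    rw [div_lt_iff₀ (by positivity)]
    have : (N:ℝ) ≤ ((n2+2 : ℕ) : ℝ) := by exact_mod_cast (by omega : N ≤ n2+2)
    nlinarith
  simp only [Set.mem_preimage, Set.mem_singleton_iff, f, Prod.mk.injEq, Subtype.ext_iff] at hn1 hn2
  obtain ⟨e1, e2⟩ := hn1
  obtain ⟨e3, e4⟩ := hn2
  rw [← e3] at e1
  rw [← e4] at e2
  generalize k (n1+2) _ = k1 at *
  generalize k (n2+2) _ = k2 at *
  generalize m (n1+2) _ = m1 at *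
  generalize m (n2+2) _ = m2 at *
  have aux : ∀ (z : ℝ), 1 ≤ z → ∀ u v : ℕ, φ (n1+2) * z^u = φ (n2+2) * z^v → ∃ r, 1 ≤ r ∧ φ (n1+2) = φ (n2+2) * z^r := by
    intro z hz u v huv
    have hlt : u < v := by
      by_contra hcon
      push Not at hcon
      have h5 := pow_le_pow_right₀ hz hcon
      have h6 : 0 < z^v := by positivity
      nlinarith
    obtain ⟨r, rfl⟩ := Nat.exists_eq_add_of_lt hlt
    refine ⟨r+1, by omega, ?_⟩
    have h6 : 0 < z^u := by positivity
    apply mul_right_cancel₀ h6.ne'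
    rw [huv]; ring
  obtain ⟨r, hr, hr'⟩ := aux a ha k1 k2 e1
  obtain ⟨r2, hr2, hr2'⟩ := aux b hb m1 m2 e2
  refine ⟨r, r2, hr, hr2, ?_⟩
  apply mul_left_cancel₀ hp2.ne'
  rw [← hr', ← hr2']

end Cob

namespace Cob

section ext
variable {Γ : Type*} (f : Γ → List Γ)

lemma applyW_append (u v : List Γ) : applyW f (u ++ v) = applyW f u ++ applyW f v := by
  simp [applyW]

lemma applyW_single (a : Γ) : applyW f [a] = f a := by simp [applyW]

lemma applyW_iter_append (k : ℕ) (u v : List Γ) :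
    (applyW f)^[k] (u ++ v) = (applyW f)^[k] u ++ (applyW f)^[k] v := by
  induction k with
  | zero => rfl
  | succ k ih => simp only [Function.iterate_succ_apply', ih, applyW_append]

lemma applyW_prefix {u v : List Γ} (h : u <+: v) : applyW f u <+: applyW f v := by
  obtain ⟨w, rfl⟩ := h
  rw [applyW_append]
  exact List.prefix_append _ _

variable {f} in
lemma length_applyW (hf : ∀ a, f a ≠ []) (u : List Γ) : u.length ≤ (applyW f u).length := by
  induction u with
  | nil => simp
  | cons b u ih =>
    have : applyW f (b :: u) = f b ++ applyW f u := by simp [applyW]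
    rw [this, List.length_append, List.length_cons]
    have := List.length_pos_iff.mpr (hf b)
    omega

def pre (y : ℕ → Γ) (n : ℕ) : List Γ := (List.range n).map y

lemma pre_succ (y : ℕ → Γ) (n : ℕ) : pre y (n+1) = pre y n ++ [y n] := by
  simp [pre, List.range_succ]

lemma pre_length (y : ℕ → Γ) (n : ℕ) : (pre y n).length = n := by simp [pre]

lemma pre_getElem? (y : ℕ → Γ) (n i : ℕ) (h : i < n) : (pre y n)[i]? = some (y i) := by
  simp [pre, h]

variable {f} {a : Γ} (hf : ∀ a, f a ≠ []) (h0 : (f a).head? = some a) (hl : 1 < (f a).length)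
include hf h0 hl

lemma W_prefix_succ (n : ℕ) : (applyW f)^[n] [a] <+: (applyW f)^[n+1] [a] := by
  induction n with
  | zero =>
    obtain ⟨t, ht⟩ := List.head?_eq_some_iff.mp h0
    simp only [Function.iterate_zero, id, zero_add, Function.iterate_one, applyW_single, ht]
    exact ⟨t, rfl⟩
  | succ n ih =>
    rw [Function.iterate_succ_apply' _ n, Function.iterate_succ_apply' _ (n+1)]
    exact applyW_prefix f ih

lemma W_prefix {n m : ℕ} (h : n ≤ m) : (applyW f)^[n] [a] <+: (applyW f)^[m] [a] := by
  induction m, h using Nat.le_induction with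
  | base => exact List.prefix_rfl
  | succ m _ ih => exact ih.trans (W_prefix_succ hf h0 hl m)

lemma W_length (n : ℕ) : n + 1 ≤ ((applyW f)^[n] [a]).length := by
  induction n with
  | zero => simp
  | succ n ih =>
    obtain ⟨t, ht⟩ := W_prefix hf h0 hl (Nat.zero_le n)
    simp only [Function.iterate_zero, id] at ht
    rw [Function.iterate_succ_apply']
    rw [← ht] at ih ⊢
    rw [applyW_append, applyW_single]
    simp only [List.length_append, List.length_singleton] at ih ⊢
    have := length_applyW hf t
    omega

lemma W_get (m n : ℕ) (h : n < ((applyW f)^[m] [a]).length) :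
    ((applyW f)^[m] [a])[n]? = some (fixpt f a n) := by
  have h1 := W_length hf h0 hl (n+1)
  have key : ((applyW f)^[m] [a])[n]? = ((applyW f)^[n+1] [a])[n]? := by
    rcases le_total m (n+1) with hle | hle
    · obtain ⟨t, ht⟩ := W_prefix hf h0 hl hle
      rw [← ht, List.getElem?_append_left h]
    · obtain ⟨t, ht⟩ := W_prefix hf h0 hl hle
      rw [← ht, List.getElem?_append_left (by omega)]
  rw [key]
  unfold fixpt
  rw [List.getD_eq_getElem?_getD, List.getElem?_eq_getElem (by omega)]
  simp

lemma prefix_eq_pre {u : List Γ} {m : ℕ} (h : u <+: (applyW f)^[m] [a]) :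
    u = pre (fixpt f a) u.length := by
  apply List.ext_getElem?
  intro i
  by_cases hi : i < u.length
  · rw [pre_getElem? _ _ _ hi]
    obtain ⟨t, ht⟩ := h
    have := W_get hf h0 hl m i (by rw [← ht, List.length_append]; omega)
    rw [← ht, List.getElem?_append_left hi] at this
    exact this
  · rw [List.getElem?_eq_none (by omega), List.getElem?_eq_none (by rw [pre_length]; omega)]

lemma pre_prefix (M : ℕ) : pre (fixpt f a) M <+: (applyW f)^[M] [a] := by
  have h1 := W_length hf h0 hl M
  have h2 := prefix_eq_pre hf h0 hl (List.take_prefix M ((applyW f)^[M] [a]))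
  rw [List.length_take, min_eq_left (by omega)] at h2
  rw [← h2]
  exact List.take_prefix _ _

omit hf h0 hl in
/-- the position map -/
def pos (f : Γ → List Γ) (a : Γ) (M : ℕ) : ℕ := (applyW f (pre (fixpt f a) M)).length

lemma applyW_pre (M : ℕ) : applyW f (pre (fixpt f a) M) = pre (fixpt f a) (pos f a M) := by
  have := applyW_prefix f (pre_prefix hf h0 hl M)
  rw [← Function.iterate_succ_apply' (applyW f)] at this
  exact prefix_eq_pre hf h0 hl this

lemma applyW_iter_pre (k M : ℕ) : (applyW f)^[k] (pre (fixpt f a) M) = pre (fixpt f a) ((pos f a)^[k] M) := by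
  induction k with
  | zero => rfl
  | succ k ih => simp only [Function.iterate_succ_apply', ih, applyW_pre hf h0 hl]

lemma pre_block (k j : ℕ) : pre (fixpt f a) ((pos f a)^[k] (j+1)) =
    pre (fixpt f a) ((pos f a)^[k] j) ++ (applyW f)^[k] [fixpt f a j] := by
  rw [← applyW_iter_pre hf h0 hl, pre_succ, applyW_iter_append, applyW_iter_pre hf h0 hl]

lemma pos_block (k j : ℕ) : (pos f a)^[k] (j+1) = (pos f a)^[k] j + ((applyW f)^[k] [fixpt f a j]).length := by
  have := congrArg List.length (pre_block hf h0 hl k j)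
  simpa [pre_length] using this

lemma get_block (k j t : ℕ) (ht : t < ((applyW f)^[k] [fixpt f a j]).length) :
    ((applyW f)^[k] [fixpt f a j])[t]? = some (fixpt f a ((pos f a)^[k] j + t)) := by
  have h1 := pos_block hf h0 hl k j
  have h2 := pre_getElem? (fixpt f a) ((pos f a)^[k] (j+1)) ((pos f a)^[k] j + t) (by omega)
  rw [pre_block hf h0 hl, List.getElem?_append_right (by rw [pre_length]; omega), pre_length,
    Nat.add_sub_cancel_left] at h2
  exact h2

lemma ss_fixpt [DecidableEq Γ] (hp : ∃ k > 0, ∀ i j : Γ, 0 < ((applyW f)^[k] [j]).count i) :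
    SS (fixpt f a) (pos f a) := by
  have hb := pos_block hf h0 hl 1
  have hg := get_block hf h0 hl 1
  simp only [Function.iterate_one, applyW_single] at hb hg
  refine ⟨by simp [pos, pre, applyW], strictMono_nat_of_lt_succ fun n => ?_, ?_, ?_, ?_⟩
  · rw [hb n]
    have := List.length_pos_iff.mpr (hf (fixpt f a n))
    omega
  · have h1 : fixpt f a 0 = a := by
      have := W_get hf h0 hl 0 0 (by simp)
      simpa using this.symm
    have h2 := hb 0
    rw [h1] at h2
    simp only [zero_add] at h2
    omega
  · intro i j hij
    refine ⟨(f (fixpt f a i)).length, hb i, by rw [hij]; exact hb j, fun t ht => ?_⟩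
    have h1 := hg i t ht
    have h2 := hg j t (by rw [← hij]; exact ht)
    rw [hij, h2] at h1
    exact (Option.some_injective _ h1).symm
  · obtain ⟨q, -, hq⟩ := hp
    refine ⟨q, fun j b => ?_⟩
    have hm := List.count_pos_iff.mp (hq b (fixpt f a j))
    obtain ⟨t, ht, hb⟩ := List.mem_iff_getElem.mp hm
    have h1 := get_block hf h0 hl q j t ht
    rw [List.getElem?_eq_getElem ht, hb] at h1
    have h2 := pos_block hf h0 hl q j
    exact ⟨_, Nat.le_add_right _ _, by omega, (Option.some_injective _ h1).symm⟩

lemma count_pos_eq [DecidableEq Γ] (b : Γ) (M : ℕ) :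
    Sm (fun i => if fixpt f a i = b then 1 else 0) (pos f a M) =
      Sm (fun j => ((f (fixpt f a j)).count b : ℝ)) M := by
  have hc : ∀ N, Sm (fun i => if fixpt f a i = b then 1 else 0) N = ((pre (fixpt f a) N).count b : ℝ) := by
    intro N
    induction N with
    | zero => simp [Sm, pre]
    | succ N ih =>
      unfold Sm at ih ⊢
      rw [Finset.sum_range_succ, ih, pre_succ, List.count_append, List.count_singleton]
      push_cast
      congr 1
      simp
  rw [hc]
  induction M with
  | zero => simp [Sm, pos, pre, applyW]
  | succ M ih =>
    have h1 := pre_block hf h0 hl 1 M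
    simp only [Function.iterate_one, applyW_single] at h1
    unfold Sm at ih ⊢
    rw [h1, List.count_append, Finset.sum_range_succ, ← ih]
    push_cast; ring

end ext

theorem rate_eq (n : ℕ) [NeZero n] (f : Fin n → List (Fin n)) (hf : ∀ a, f a ≠ [])
    (hp : ∃ k > 0, ∀ i j : Fin n, 0 < ((applyW f)^[k] [j]).count i)
    (h0 : (f 0).head? = some 0) (hl : 1 < (f 0).length)
    (lf : ℝ) (hlf : 0 < lf)
    (hlfeig : (lf : ℂ) ∈ spectrum ℂ (Matrix.of fun i j : Fin n => ((f j).count i : ℂ)))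
    (hlfdom : ∀ μ ∈ spectrum ℂ (Matrix.of fun i j : Fin n => ((f j).count i : ℂ)), ‖μ‖ ≤ lf) :
    SS (fixpt f 0) (pos f 0) ∧ 1 ≤ lf ∧
      Tendsto (fun M : ℕ => (pos f 0 M : ℝ) / M) atTop (𝓝 lf) := by
  have h := ss_fixpt hf h0 hl hp
  obtain ⟨Λ, hΛ1, hΛ⟩ := rate_exists h
  set y := fixpt f 0 with hy
  suffices hEq : Λ = lf by rw [← hEq]; exact ⟨h, hΛ1, hΛ⟩
  have hex : ∀ b : Fin n, ∃ s, Tendsto (fun N : ℕ => Sm (fun i => if y i = b then 1 else 0) N / N) atTop (𝓝 s) := by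
    intro b
    refine mean h (Hb := 1) (n0 := 1) (fun i => by split_ifs <;> norm_num) (fun i => by split_ifs <;> norm_num)
      (fun i j hij => ?_)
    have h1 := hij 0 (by norm_num)
    simp only [add_zero] at h1
    simp only [h1]
  choose φ hφ using hex
  have hφpos : ∀ b, 0 < φ b := by
    intro b
    obtain ⟨q, hq⟩ := h.prim
    obtain ⟨i, -, -, hi⟩ := hq 0 b
    refine mean_pos h (n0 := 1) (fun i => by split_ifs <;> norm_num)
      (fun i j hij => ?_) (hφ b) i (by simp [hi])
    have h1 := hij 0 (by norm_num)
    simp only [add_zero] at h1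
    simp only [h1]
  have heig : ∀ b, ∑ c, ((f c).count b : ℝ) * φ c = Λ * φ b := by
    intro b
    have t1 := Sm_ratio (hφ b) h.mono hΛ
    have t2 : Tendsto (fun M : ℕ => ∑ c, ((f c).count b : ℝ) * (Sm (fun i => if y i = c then 1 else 0) M / M))
        atTop (𝓝 (∑ c, ((f c).count b : ℝ) * φ c)) :=
      tendsto_finsetSum _ fun c _ => (hφ c).const_mul _
    rw [mul_comm]
    refine tendsto_nhds_unique t2 (t1.congr fun M => ?_)
    rw [count_pos_eq hf h0 hl b M]
    simp only [← mul_div_assoc, ← Finset.sum_div]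
    congr 1
    unfold Sm
    simp only [Finset.mul_sum]
    rw [Finset.sum_comm]
    apply Finset.sum_congr rfl
    intro j _
    simp [hy]
  apply le_antisymm
  · have hmem : (Λ : ℂ) ∈ spectrum ℂ (Matrix.of fun i j : Fin n => ((f j).count i : ℂ)) := by
      rw [← Matrix.spectrum_toLin', ← Module.End.hasEigenvalue_iff_mem_spectrum]
      apply Module.End.hasEigenvalue_of_hasEigenvector (x := fun b => (φ b : ℂ))
      rw [Module.End.hasEigenvector_iff, Module.End.mem_eigenspace_iff]
      refine ⟨?_, ?_⟩
      · ext b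
        have := heig b
        simp only [Matrix.toLin'_apply, Matrix.mulVec, dotProduct, Matrix.of_apply, Pi.smul_apply, smul_eq_mul]
        exact_mod_cast this
      · intro hz
        have := congrFun hz 0
        have h2 := hφpos 0
        simp at this
        linarith
    have := hlfdom _ hmem
    rw [Complex.norm_real, Real.norm_eq_abs] at this
    exact (le_abs_self _).trans this
  · have hT : (lf : ℂ) ∈ spectrum ℂ (Matrix.of fun i j : Fin n => ((f j).count i : ℂ)).transpose := by
      rw [Matrix.mem_spectrum_iff_isRoot_charpoly, Matrix.charpoly_transpose,
        ← Matrix.mem_spectrum_iff_isRoot_charpoly]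
      exact hlfeig
    rw [← Matrix.spectrum_toLin', ← Module.End.hasEigenvalue_iff_mem_spectrum] at hT
    obtain ⟨z, hz⟩ := hT.exists_hasEigenvector
    rw [Module.End.hasEigenvector_iff, Module.End.mem_eigenspace_iff] at hz
    obtain ⟨hz1, hz2⟩ := hz
    have hin : ∀ c, lf * ‖z c‖ ≤ ∑ b, ((f c).count b : ℝ) * ‖z b‖ := by
      intro c
      have := congrFun hz1 c
      simp only [Matrix.toLin'_apply, Matrix.mulVec, dotProduct, Matrix.of_apply, Matrix.transpose_apply,
        Pi.smul_apply, smul_eq_mul] at this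
      have h2 := congrArg norm this
      rw [norm_mul, Complex.norm_real, Real.norm_of_nonneg hlf.le] at h2
      rw [← h2]
      refine (norm_sum_le _ _).trans (le_of_eq ?_)
      simp
    have hpos : 0 < ∑ c, ‖z c‖ * φ c := by
      obtain ⟨c, hc⟩ := Function.ne_iff.mp hz2
      apply Finset.sum_pos'
      · intro i _; exact mul_nonneg (norm_nonneg _) (hφpos i).le
      · exact ⟨c, Finset.mem_univ _, mul_pos (norm_pos_iff.mpr hc) (hφpos c)⟩
    have hfin : lf * ∑ c, ‖z c‖ * φ c ≤ Λ * ∑ c, ‖z c‖ * φ c := by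
      calc lf * ∑ c, ‖z c‖ * φ c = ∑ c, (lf * ‖z c‖) * φ c := by
            rw [Finset.mul_sum]; exact Finset.sum_congr rfl fun c _ => by ring
        _ ≤ ∑ c, (∑ b, ((f c).count b : ℝ) * ‖z b‖) * φ c :=
            Finset.sum_le_sum fun c _ => mul_le_mul_of_nonneg_right (hin c) (hφpos c).le
        _ = ∑ b, ‖z b‖ * ∑ c, ((f c).count b : ℝ) * φ c := by
            simp only [Finset.sum_mul, Finset.mul_sum]
            rw [Finset.sum_comm]
            exact Finset.sum_congr rfl fun c _ => Finset.sum_congr rfl fun b _ => by ring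
        _ = Λ * ∑ c, ‖z c‖ * φ c := by
            simp only [heig, Finset.mul_sum]
            exact Finset.sum_congr rfl fun c _ => by ring
    exact le_of_mul_le_mul_right hfin hpos

end Cob

/-- Theorem 1 (Durand): if `f, g` are primitive and `τ(f^∞(0)) = ρ(g^∞(0))` is
not periodic, then some powers `f^k` and `g^m` have the same dominant
eigenvalue, i.e. `λ_f^k = λ_g^m`. Here the dominant eigenvalue of a morphism is
the positive real eigenvalue of its incidence matrix dominating the absolute
values of all other (complex) eigenvalues. -/
theorem stmt_9 {S : Type*} (nf ng : ℕ) [NeZero nf] [NeZero ng]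
    (f : Fin nf → List (Fin nf)) (g : Fin ng → List (Fin ng))
    (hf : ∀ a, f a ≠ []) (hg : ∀ a, g a ≠ [])
    -- primitivity: some power of the incidence matrix has all entries positive,
    -- i.e. every letter `i` occurs in `f^k(j)` for all `i, j`
    (hfprim : ∃ k > 0, ∀ i j : Fin nf, 0 < ((applyW f)^[k] [j]).count i)
    (hgprim : ∃ k > 0, ∀ i j : Fin ng, 0 < ((applyW g)^[k] [j]).count i)
    (hf0 : (f 0).head? = some 0) (hf0len : 1 < (f 0).length)
    (hg0 : (g 0).head? = some 0) (hg0len : 1 < (g 0).length)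
    (τ : Fin nf → S) (ρ : Fin ng → S)
    (heq : applyC τ (fixpt f 0) = applyC ρ (fixpt g 0))
    -- the common sequence is not periodic
    (hnotper : ¬ ∃ p > 0, ∀ i : ℕ,
        applyC τ (fixpt f 0) (i + p) = applyC τ (fixpt f 0) i)
    -- `lf`, `lg` are the dominant eigenvalues of the incidence matrices
    (lf lg : ℝ) (hlf : 0 < lf) (hlg : 0 < lg)
    (hlfeig : (lf : ℂ) ∈ spectrum ℂ (Matrix.of fun i j : Fin nf => ((f j).count i : ℂ)))
    (hlfdom : ∀ μ ∈ spectrum ℂ (Matrix.of fun i j : Fin nf => ((f j).count i : ℂ)),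
        ‖μ‖ ≤ lf)
    (hlgeig : (lg : ℂ) ∈ spectrum ℂ (Matrix.of fun i j : Fin ng => ((g j).count i : ℂ)))
    (hlgdom : ∀ μ ∈ spectrum ℂ (Matrix.of fun i j : Fin ng => ((g j).count i : ℂ)),
        ‖μ‖ ≤ lg) :
    ∃ k m : ℕ, 1 ≤ k ∧ 1 ≤ m ∧ lf ^ k = lg ^ m := by
  obtain ⟨hs1, h1, hr1⟩ := Cob.rate_eq nf f hf hfprim hf0 hf0len lf hlf hlfeig hlfdom
  obtain ⟨hs2, h2, hr2⟩ := Cob.rate_eq ng g hg hgprim hg0 hg0len lg hlg hlgeig hlgdom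
  have hnotper2 : ¬ ∃ p > 0, ∀ i : ℕ,
        applyC ρ (fixpt g 0) (i + p) = applyC ρ (fixpt g 0) i := by
    rw [← heq]; exact hnotper
  obtain ⟨F, K, hF, HF⟩ := Cob.main_one hs1 τ hnotper hr1
  obtain ⟨G, K', hG, HG⟩ := Cob.main_one hs2 ρ hnotper2 hr2
  have hx : (fun i => τ (fixpt f 0 i)) = (fun i => ρ (fixpt g 0 i)) := heq
  have key : ∀ n : ℕ, ∃ s : ℝ, n ≥ 2 → 0 < s ∧ s ≤ K / n ∧ (∃ k : ℕ, s * lf^k ∈ F) ∧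
      ∃ m : ℕ, s * lg^m ∈ G := by
    intro n
    by_cases hn : n ≥ 2
    · obtain ⟨s, a1, a2, a3, a4⟩ := HF n hn
      obtain ⟨s', b1, b2, b3, b4⟩ := HG n hn
      rw [hx] at a1
      have := tendsto_nhds_unique a1 b1
      subst this
      exact ⟨s, fun _ => ⟨a2, a3, a4, b4⟩⟩
    · exact ⟨0, fun h => absurd h hn⟩
  choose φ hφ using key
  exact Cob.final h1 h2 hF hG hφ
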